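/- Let M be a finite dimensional semisimple left H_{mn}(ξ)-module. Then the composition length of M equals dim_𝕜 M^d, where M^d = {v ∈ M : d·v = 0}. -/

import Mathlib

noncomputable section

namespace Radford

variable (𝕜 : Type) [Field 𝕜]

/-- The q-integer `(k)_q = 1 + q + ⋯ + q^(k-1)`. -/
def qInt (q : 𝕜) (k : ℕ) : 𝕜 := ∑ j ∈ Finset.range k, q ^ j

/-- The q-factorial `(k)!_q = (1)_q (2)_q ⋯ (k)_q`. -/
def qFact (q : 𝕜) : ℕ → 𝕜
  | 0 => 1
  | k + 1 => qFact q k * qInt 𝕜 q (k + 1)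

variable (m n : ℕ) (ξ : 𝕜)

/-- Generators of the free algebra: 0 ↦ a, 1 ↦ b, 2 ↦ c, 3 ↦ d. -/
def fgen (k : Fin 4) : FreeAlgebra 𝕜 (Fin 4) := FreeAlgebra.ι 𝕜 k

local notation "fa" => fgen 𝕜 0
local notation "fb" => fgen 𝕜 1
local notation "fc" => fgen 𝕜 2
local notation "fd" => fgen 𝕜 3

/-- The defining relations of the Drinfeld double `H_{mn}(ξ) = D(R_{mn}(q))`, where `q = ξ^m`. -/
inductive HRel : FreeAlgebra 𝕜 (Fin 4) → FreeAlgebra 𝕜 (Fin 4) → Prop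
  | aPow : HRel (fa ^ n) (fb ^ n - 1)
  | bPow : HRel (fb ^ (m * n)) 1
  | cPow : HRel (fc ^ (m * n)) 1
  | dPow : HRel (fd ^ n) 0
  | ab : HRel (fa * fb) (ξ ^ m • (fb * fa))
  | dc : HRel (fd * fc) (ξ • (fc * fd))
  | bc : HRel (fb * fc) (fc * fb)
  | bd : HRel (fb * fd) (ξ ^ m • (fd * fb))
  | ad : HRel (fa * fd - fd * fa) (fb - fc ^ m)
  | ac : HRel (fa * fc)
      (ξ⁻¹ • (fc * fa) +
        ((ξ⁻¹ - ξ ^ (n - 1)) / qFact 𝕜 (ξ ^ m) (n - 1)) •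
          ((fc ^ (m + 1) - ξ ^ m • (fb * fc)) * fd ^ (n - 1)))

/-- The Drinfeld double `H_{mn}(ξ)` of the Radford Hopf algebra `R_{mn}(q)`, presented by
generators `a, b, c, d` and the above relations. -/
def H := RingQuot (HRel 𝕜 m n ξ)

instance : Ring (H 𝕜 m n ξ) := inferInstanceAs (Ring (RingQuot (HRel 𝕜 m n ξ)))

instance : Algebra 𝕜 (H 𝕜 m n ξ) := inferInstanceAs (Algebra 𝕜 (RingQuot (HRel 𝕜 m n ξ)))

/-- The generators `a, b, c, d` of `H_{mn}(ξ)` (indexed by 0,1,2,3). -/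
def gen (k : Fin 4) : H 𝕜 m n ξ := RingQuot.mkAlgHom 𝕜 (HRel 𝕜 m n ξ) (fgen 𝕜 k)

local notation "ha" => gen 𝕜 m n ξ 0
local notation "hb" => gen 𝕜 m n ξ 1
local notation "hc" => gen 𝕜 m n ξ 2
local notation "hd" => gen 𝕜 m n ξ 3

/-- The Jacobson radical `J` of `H_{mn}(ξ)`. -/
def jrad : Ideal (H 𝕜 m n ξ) := Ideal.jacobson ⊥

/-- The scalars `α_k(l,i)`;  `alph l i k` is `α_k(l,i)`, where `q = ξ^m`. -/
def alph (l : ℕ) (i : ℤ) (k : ℕ) : 𝕜 :=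
  if k = n then ((ξ ^ m) ^ (i + (l : ℤ)) - (ξ ^ m) ^ i) / qFact 𝕜 (ξ ^ m) (n - 1)
  else qInt 𝕜 (ξ ^ m) k * ((ξ ^ m) ^ i - (ξ ^ m) ^ (i + (l : ℤ) - (k : ℤ)))

/-- The scalars `γ_k(l,i)`;  `gam l i k` is `γ_k(l,i)`, where `q = ξ^m`. -/
def gam (l : ℕ) (i : ℤ) (k : ℕ) : 𝕜 :=
  if k = n then ((ξ ^ m) ^ i - (ξ ^ m) ^ (i + (l : ℤ))) / qFact 𝕜 (ξ ^ m) (n - 1)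
  else qInt 𝕜 (ξ ^ m) k * ((ξ ^ m) ^ (i + (l : ℤ)) - (ξ ^ m) ^ (i - (k : ℤ)))

section ModuleH

variable {W : Type} [AddCommGroup W] [Module (H 𝕜 m n ξ) W]

variable (W) in
/-- The socle of an `H`-module: the sum of all simple submodules. -/
def socle : Submodule (H 𝕜 m n ξ) W :=
  sSup {N : Submodule (H 𝕜 m n ξ) W | IsSimpleModule (H 𝕜 m n ξ) N}

variable (W) in
/-- The submodule `J•W`, the radical of `W`. -/
def radM : Submodule (H 𝕜 m n ξ) W :=
  Submodule.span (H 𝕜 m n ξ) {x | ∃ r ∈ jrad 𝕜 m n ξ, ∃ w : W, x = r • w}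

variable (W) in
/-- The submodule `J²•W`. -/
def rad2M : Submodule (H 𝕜 m n ξ) W :=
  Submodule.span (H 𝕜 m n ξ)
    {x | ∃ r ∈ jrad 𝕜 m n ξ, ∃ s ∈ jrad 𝕜 m n ξ, ∃ w : W, x = r • s • w}

variable (W) in
/-- The submodule `J³•W`. -/
def rad3M : Submodule (H 𝕜 m n ξ) W :=
  Submodule.span (H 𝕜 m n ξ)
    {x | ∃ r ∈ jrad 𝕜 m n ξ, ∃ s ∈ jrad 𝕜 m n ξ, ∃ t ∈ jrad 𝕜 m n ξ, ∃ w : W, x = r • s • t • w}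

variable (W) in
/-- `lengthIs c W` : the `H`-module `W` has a composition series of length `c`
(hence, by Jordan–Hölder, has composition length `c`). -/
def lengthIs (c : ℕ) : Prop :=
  ∃ s : CompositionSeries (Submodule (H 𝕜 m n ξ) W), s.head = ⊥ ∧ s.last = ⊤ ∧ s.length = c

variable (W) in
/-- An `H`-module is indecomposable if it is nonzero and is not the direct sum of two
nonzero submodules. -/
def Indec : Prop :=
  Nontrivial W ∧ ∀ N₁ N₂ : Submodule (H 𝕜 m n ξ) W, IsCompl N₁ N₂ → N₁ = ⊥ ∨ N₂ = ⊥

variable (W) in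
/-- `W` has Loewy length 2: `J•W ≠ 0` and `J²•W = 0`. -/
def LoewyLen2 : Prop := radM 𝕜 m n ξ W ≠ ⊥ ∧ rad2M 𝕜 m n ξ W = ⊥

variable (W) in
/-- `W` is of `(s,t)`-type: it has Loewy length `2`, its socle has composition length `t`,
and `W/soc W` has composition length `s`. -/
def IsType (s t : ℕ) : Prop :=
  LoewyLen2 𝕜 m n ξ W ∧ lengthIs 𝕜 m n ξ (socle 𝕜 m n ξ W) t ∧
    lengthIs 𝕜 m n ξ (W ⧸ socle 𝕜 m n ξ W) s

end ModuleH

section ModuleK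

variable {V : Type} [AddCommGroup V] [Module 𝕜 V] [Module (H 𝕜 m n ξ) V]
  [IsScalarTower 𝕜 (H 𝕜 m n ξ) V]

variable (V) in
/-- `V^d = {v ∈ V | d•v = 0}`, as a `𝕜`-subspace. -/
def dKer : Submodule 𝕜 V where
  carrier := {v | hd • v = 0}
  add_mem' := by
    intro x y hx hy
    simp only [Set.mem_setOf_eq] at *
    rw [smul_add, hx, hy, add_zero]
  zero_mem' := smul_zero _
  smul_mem' := by
    intro r v hv
    simp only [Set.mem_setOf_eq] at *
    rw [smul_comm, hv, smul_zero]

variable (V) in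
/-- `V_{(i)} = {v ∈ V | c•v = ξ^i v}`, as a `𝕜`-subspace. -/
def eigsp (i : ℤ) : Submodule 𝕜 V where
  carrier := {v | hc • v = ξ ^ i • v}
  add_mem' := by
    intro x y hx hy
    simp only [Set.mem_setOf_eq] at *
    rw [smul_add, hx, hy, smul_add]
  zero_mem' := by simp
  smul_mem' := by
    intro r v hv
    simp only [Set.mem_setOf_eq] at *
    rw [smul_comm, hv, smul_comm]

/-- `V`, equipped with the family `mv : Fin l → V`, realizes the simple module `M(l,i)`:
`mv` is a basis of `V` and the generators act by the defining formulas of `M(l,i)`. -/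
def IsMrep (l : ℕ) (i : ℤ) (mv : Fin l → V) : Prop :=
  LinearIndependent 𝕜 mv ∧ Submodule.span 𝕜 (Set.range mv) = ⊤ ∧
  (∀ (j : ℕ) (hj : j + 1 < l),
    ha • mv ⟨j, by omega⟩ = alph 𝕜 m n ξ l i (j + 1) • mv ⟨j + 1, hj⟩) ∧
  (∀ (j : ℕ) (hj : j < l), j + 1 = l → ha • mv ⟨j, hj⟩ = 0) ∧
  (∀ j : Fin l, hb • mv j = ((ξ ^ m) ^ (i + (l : ℤ) - ((j : ℕ) + 1 : ℤ)) : 𝕜) • mv j) ∧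
  (∀ j : Fin l, hc • mv j = (ξ ^ (i + (j : ℕ) : ℤ) : 𝕜) • mv j) ∧
  (∀ (j : ℕ) (hj : j + 1 < l), hd • mv ⟨j + 1, hj⟩ = mv ⟨j, by omega⟩) ∧
  (∀ hl : 0 < l, hd • mv ⟨0, hl⟩ = 0)

/-- `V` realizes the induced module `Z(λ_{ij})`: there is a cyclic vector `z` with
`d•z = 0`, `b•z = ξ^j z`, `c•z = ξ^i z` such that `(a^k • z)_{0 ≤ k ≤ n-1}` is a basis. -/
def IsZrep (i j : ℤ) (V : Type) [AddCommGroup V] [Module 𝕜 V] [Module (H 𝕜 m n ξ) V]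
    [IsScalarTower 𝕜 (H 𝕜 m n ξ) V] : Prop :=
  ∃ z : V, hd • z = 0 ∧ hb • z = (ξ ^ j : 𝕜) • z ∧ hc • z = (ξ ^ i : 𝕜) • z ∧
    LinearIndependent 𝕜 (fun k : Fin n => (ha ^ (k : ℕ)) • z) ∧
    Submodule.span 𝕜 (Set.range fun k : Fin n => (ha ^ (k : ℕ)) • z) = ⊤

/-- `V`, equipped with the families `v u : Fin n → V`, realizes the projective module `P(l,i)`
with its standard basis. -/
def IsPrep (l : ℕ) (hl1 : 1 ≤ l) (hl2 : l < n) (i : ℤ) (v u : Fin n → V) : Prop :=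
  LinearIndependent 𝕜 (Sum.elim v u) ∧
  Submodule.span 𝕜 (Set.range v ∪ Set.range u) = ⊤ ∧
  (∀ (j : ℕ) (hj : j + l + 2 ≤ n),
    ha • v ⟨j, by omega⟩ = gam 𝕜 m n ξ l i (j + 1) • v ⟨j + 1, by omega⟩) ∧
  (∀ (j : ℕ) (hj : j + 1 < n), n ≤ j + 1 + l →
    ha • v ⟨j, by omega⟩ =
      gam 𝕜 m n ξ l i (j + 1) • v ⟨j + 1, hj⟩ + u ⟨j + 1 + l - n, by omega⟩) ∧
  (ha • v ⟨n - 1, by omega⟩ = gam 𝕜 m n ξ l i n • v ⟨0, by omega⟩ + u ⟨l, by omega⟩) ∧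
  (∀ (j : ℕ) (hj : j + 1 < n),
    ha • u ⟨j, by omega⟩ = alph 𝕜 m n ξ l i (j + 1) • u ⟨j + 1, hj⟩) ∧
  (ha • u ⟨n - 1, by omega⟩ = alph 𝕜 m n ξ l i n • u ⟨0, by omega⟩) ∧
  (∀ j : Fin n, hb • v j = ((ξ ^ m) ^ (i + (n : ℤ) - ((j : ℕ) + 1 : ℤ)) : 𝕜) • v j) ∧
  (∀ j : Fin n, hb • u j = ((ξ ^ m) ^ (i + (l : ℤ) - ((j : ℕ) + 1 : ℤ)) : 𝕜) • u j) ∧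
  (∀ j : Fin n, hc • v j = (ξ ^ (i - ((n : ℤ) - (l : ℤ)) + (j : ℕ) : ℤ) : 𝕜) • v j) ∧
  (∀ j : Fin n, hc • u j = (ξ ^ (i + (j : ℕ) : ℤ) : 𝕜) • u j) ∧
  (hd • v ⟨0, by omega⟩ = 0) ∧
  (∀ (j : ℕ) (hj : j + 1 < n), hd • v ⟨j + 1, hj⟩ = v ⟨j, by omega⟩) ∧
  (hd • u ⟨0, by omega⟩ = 0) ∧
  (∀ (j : ℕ) (hj : j + 1 < n), hd • u ⟨j + 1, hj⟩ = u ⟨j, by omega⟩)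

/-- `V`, equipped with the basis `e : Fin n → V`, realizes the module `T_1(l,i)`. -/
def IsT1rep (l : ℕ) (hl1 : 1 ≤ l) (hl2 : l < n) (i : ℤ) (e : Fin n → V) : Prop :=
  LinearIndependent 𝕜 e ∧ Submodule.span 𝕜 (Set.range e) = ⊤ ∧
  (∀ (j : ℕ) (hj : j + 1 < n),
    ha • e ⟨j, by omega⟩ = alph 𝕜 m n ξ l i (j + 1) • e ⟨j + 1, hj⟩) ∧
  (ha • e ⟨n - 1, by omega⟩ = alph 𝕜 m n ξ l i n • e ⟨0, by omega⟩) ∧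
  (∀ j : Fin n, hb • e j = ((ξ ^ m) ^ (i + (l : ℤ) - ((j : ℕ) + 1 : ℤ)) : 𝕜) • e j) ∧
  (∀ j : Fin n, hc • e j = (ξ ^ (i + (j : ℕ) : ℤ) : 𝕜) • e j) ∧
  (hd • e ⟨0, by omega⟩ = 0) ∧
  (∀ (j : ℕ) (hj : j + 1 < n), hd • e ⟨j + 1, hj⟩ = e ⟨j, by omega⟩)

/-- `V`, equipped with the basis `e : Fin n → V`, realizes the module `T̄_1(l,i)`. -/
def IsT1barrep (l : ℕ) (hl1 : 1 ≤ l) (hl2 : l < n) (i : ℤ) (e : Fin n → V) : Prop :=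
  LinearIndependent 𝕜 e ∧ Submodule.span 𝕜 (Set.range e) = ⊤ ∧
  (∀ (j : ℕ) (hj : j + 1 < n - l),
    ha • e ⟨j, by omega⟩ = alph 𝕜 m n ξ (n - l) (i + l - n) (j + 1) • e ⟨j + 1, by omega⟩) ∧
  (ha • e ⟨n - l - 1, by omega⟩ = e ⟨n - l, by omega⟩) ∧
  (∀ (k : ℕ) (hk : k + 1 < l),
    ha • e ⟨n - l + k, by omega⟩ = alph 𝕜 m n ξ l i (k + 1) • e ⟨n - l + k + 1, by omega⟩) ∧
  (ha • e ⟨n - 1, by omega⟩ = 0) ∧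
  (∀ j : Fin n, hb • e j = ((ξ ^ m) ^ (i - ((j : ℕ) + 1 : ℤ)) : 𝕜) • e j) ∧
  (∀ j : Fin n, hc • e j = (ξ ^ (i + (l : ℤ) - (n : ℤ) + (j : ℕ) : ℤ) : 𝕜) • e j) ∧
  (hd • e ⟨0, by omega⟩ = 0) ∧
  (∀ (j : ℕ) (hj : j + 1 < n - l), hd • e ⟨j + 1, by omega⟩ = e ⟨j, by omega⟩) ∧
  (hd • e ⟨n - l, by omega⟩ = 0) ∧
  (∀ (k : ℕ) (hk : k + 1 < l), hd • e ⟨n - l + k + 1, by omega⟩ = e ⟨n - l + k, by omega⟩)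

end ModuleK

section Matrices

/-- The nilpotent Jordan-type matrix `D_s` with `1` on the superdiagonal. -/
def Dmat (s : ℕ) : Matrix (Fin s) (Fin s) 𝕜 :=
  fun r c => if (r : ℕ) + 1 = (c : ℕ) then 1 else 0

/-- The matrix `X_{l,i}` : subdiagonal entries `γ_k(l,i)`, `(1,n)`-entry `γ_n(l,i)`. -/
def Xmat (l : ℕ) (i : ℤ) : Matrix (Fin n) (Fin n) 𝕜 := fun r c =>
  if (r : ℕ) = (c : ℕ) + 1 then gam 𝕜 m n ξ l i ((c : ℕ) + 1)
  else if (r : ℕ) = 0 ∧ (c : ℕ) = n - 1 then gam 𝕜 m n ξ l i n else 0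

/-- The matrix `Z_{l,i}` : subdiagonal entries `α_k(l,i)`, `(1,n)`-entry `α_n(l,i)`. -/
def Zmat (l : ℕ) (i : ℤ) : Matrix (Fin n) (Fin n) 𝕜 := fun r c =>
  if (r : ℕ) = (c : ℕ) + 1 then alph 𝕜 m n ξ l i ((c : ℕ) + 1)
  else if (r : ℕ) = 0 ∧ (c : ℕ) = n - 1 then alph 𝕜 m n ξ l i n else 0

/-- The block matrix `A(l,i) = [[X_{l,i}, 0], [D_n^{n-l-1}, Z_{l,i}]]`. -/
def Amat (l : ℕ) (i : ℤ) : Matrix (Fin n ⊕ Fin n) (Fin n ⊕ Fin n) 𝕜 :=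
  Matrix.fromBlocks (Xmat 𝕜 m n ξ l i) 0 (Dmat 𝕜 n ^ (n - l - 1)) (Zmat 𝕜 m n ξ l i)

/-- The diagonal matrix `B(l,i)`. -/
def Bmat (l : ℕ) (i : ℤ) : Matrix (Fin n ⊕ Fin n) (Fin n ⊕ Fin n) 𝕜 :=
  Matrix.fromBlocks
    (Matrix.diagonal fun j : Fin n => (ξ ^ m) ^ (i - ((j : ℕ) + 1 : ℤ))) 0 0
    (Matrix.diagonal fun j : Fin n => (ξ ^ m) ^ (i + (l : ℤ) - ((j : ℕ) + 1 : ℤ)))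

/-- The diagonal matrix `C(l,i)`. -/
def Cmat (l : ℕ) (i : ℤ) : Matrix (Fin n ⊕ Fin n) (Fin n ⊕ Fin n) 𝕜 :=
  Matrix.fromBlocks
    (Matrix.diagonal fun j : Fin n => ξ ^ (i + (l : ℤ) - (n : ℤ) + (j : ℕ))) 0 0
    (Matrix.diagonal fun j : Fin n => ξ ^ (i + (j : ℕ) : ℤ))

/-- The block matrix `D = diag(D_n, D_n)`. -/
def Dbig : Matrix (Fin n ⊕ Fin n) (Fin n ⊕ Fin n) 𝕜 :=
  Matrix.fromBlocks (Dmat 𝕜 n) 0 0 (Dmat 𝕜 n)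

end Matrices


section Relations

/-- The quotient map from the free algebra onto `H_{mn}(ξ)`. -/
def quotMap : FreeAlgebra 𝕜 (Fin 4) →ₐ[𝕜] H 𝕜 m n ξ := RingQuot.mkAlgHom 𝕜 (HRel 𝕜 m n ξ)

theorem quotMap_surjective : Function.Surjective (quotMap 𝕜 m n ξ) :=
  RingQuot.mkAlgHom_surjective 𝕜 _

theorem quotMap_fgen (k : Fin 4) : quotMap 𝕜 m n ξ (fgen 𝕜 k) = gen 𝕜 m n ξ k := rfl

variable {𝕜 m n ξ} in
theorem quotMap_eq_of_rel {x y : FreeAlgebra 𝕜 (Fin 4)} (h : HRel 𝕜 m n ξ x y) :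
    quotMap 𝕜 m n ξ x = quotMap 𝕜 m n ξ y :=
  RingQuot.mkAlgHom_rel 𝕜 h

theorem gen_a_pow : ha ^ n = hb ^ n - 1 := by
  simpa [quotMap_fgen] using quotMap_eq_of_rel (HRel.aPow (𝕜 := 𝕜) (m := m) (n := n) (ξ := ξ))

theorem gen_c_pow : hc ^ (m * n) = 1 := by
  simpa [quotMap_fgen] using quotMap_eq_of_rel (HRel.cPow (𝕜 := 𝕜) (m := m) (n := n) (ξ := ξ))

theorem gen_d_pow : hd ^ n = 0 := by
  simpa [quotMap_fgen] using quotMap_eq_of_rel (HRel.dPow (𝕜 := 𝕜) (m := m) (n := n) (ξ := ξ))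

theorem gen_a_mul_b : ha * hb = ξ ^ m • (hb * ha) := by
  simpa [quotMap_fgen] using
    quotMap_eq_of_rel (HRel.ab (𝕜 := 𝕜) (m := m) (n := n) (ξ := ξ))

theorem gen_d_mul_c : hd * hc = ξ • (hc * hd) := by
  simpa [quotMap_fgen] using quotMap_eq_of_rel (HRel.dc (𝕜 := 𝕜) (m := m) (n := n) (ξ := ξ))

theorem gen_b_mul_c : hb * hc = hc * hb := by
  simpa [quotMap_fgen] using quotMap_eq_of_rel (HRel.bc (𝕜 := 𝕜) (m := m) (n := n) (ξ := ξ))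

theorem gen_b_mul_d : hb * hd = ξ ^ m • (hd * hb) := by
  simpa [quotMap_fgen] using quotMap_eq_of_rel (HRel.bd (𝕜 := 𝕜) (m := m) (n := n) (ξ := ξ))

theorem gen_a_mul_d : ha * hd - hd * ha = hb - hc ^ m := by
  simpa [quotMap_fgen] using quotMap_eq_of_rel (HRel.ad (𝕜 := 𝕜) (m := m) (n := n) (ξ := ξ))

theorem gen_a_mul_c : ha * hc = ξ⁻¹ • (hc * ha) +
    ((ξ⁻¹ - ξ ^ (n - 1)) / qFact 𝕜 (ξ ^ m) (n - 1)) •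
      ((hc ^ (m + 1) - ξ ^ m • (hb * hc)) * hd ^ (n - 1)) := by
  simpa only [map_mul, map_add, map_smul, map_sub, map_pow, quotMap_fgen] using
    quotMap_eq_of_rel (HRel.ac (𝕜 := 𝕜) (m := m) (n := n) (ξ := ξ))

end Relations

section DKernel

variable {𝕜 m n ξ}
variable {V : Type} [AddCommGroup V] [Module 𝕜 V] [Module (H 𝕜 m n ξ) V]
  [IsScalarTower 𝕜 (H 𝕜 m n ξ) V]

/-- A `𝕜`-subspace stable under the four generators is stable under all of `H_{mn}(ξ)`. -/
theorem smul_mem_of_gen_smul_mem (N : Submodule 𝕜 V)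
    (hN : ∀ k, ∀ v ∈ N, gen 𝕜 m n ξ k • v ∈ N) (x : H 𝕜 m n ξ) {v : V} (hv : v ∈ N) :
    x • v ∈ N := by
  obtain ⟨x, rfl⟩ := quotMap_surjective 𝕜 m n ξ x
  induction x using FreeAlgebra.induction generalizing v with
  | grade0 r => rw [AlgHom.commutes, algebraMap_smul]; exact N.smul_mem r hv
  | grade1 k => exact hN k v hv
  | mul x y hx hy => rw [map_mul, mul_smul]; exact hx (hy hv)
  | add x y hx hy => rw [map_add, add_smul]; exact N.add_mem (hx hv) (hy hv)

theorem eq_top_of_gen_smul_mem [IsSimpleModule (H 𝕜 m n ξ) V] (N : Submodule 𝕜 V)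
    (hN : ∀ k, ∀ v ∈ N, gen 𝕜 m n ξ k • v ∈ N) {v : V} (hv : v ∈ N) (hv0 : v ≠ 0) :
    N = ⊤ := by
  let N' : Submodule (H 𝕜 m n ξ) V :=
    { N with smul_mem' := fun x _ hv => smul_mem_of_gen_smul_mem N hN x hv }
  have hN' : N' = ⊤ := (eq_bot_or_eq_top N').resolve_left fun h =>
    hv0 ((Submodule.mem_bot _).1 (h ▸ (show v ∈ N' from hv)))
  exact eq_top_iff.2 fun w _ => show w ∈ N' from hN' ▸ Submodule.mem_top

/-- An endomorphism preserving a nonzero subspace has an eigenvector in it. -/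
theorem exists_eigenvector_mem {K E : Type*} [Field K] [IsAlgClosed K] [AddCommGroup E]
    [Module K E] [FiniteDimensional K E] (f : Module.End K E) (N : Submodule K E)
    (hN : N ≠ ⊥) (hf : ∀ v ∈ N, f v ∈ N) : ∃ μ : K, ∃ v ∈ N, v ≠ 0 ∧ f v = μ • v := by
  have : Nontrivial N := Submodule.nontrivial_iff_ne_bot.2 hN
  obtain ⟨μ, hμ⟩ := Module.End.exists_eigenvalue (f.restrict hf)
  obtain ⟨v, hv⟩ := hμ.exists_hasEigenvector
  exact ⟨μ, v, v.2, fun h => hv.2 (Subtype.ext h), congrArg Subtype.val hv.apply_eq_smul⟩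

theorem pow_smul_eq {x : H 𝕜 m n ξ} {v : V} {μ : 𝕜} (h : x • v = μ • v) (k : ℕ) :
    x ^ k • v = μ ^ k • v := by
  induction k with
  | zero => simp
  | succ k ih => rw [pow_succ, mul_smul, h, smul_comm, ih, smul_smul, pow_succ, mul_comm]

theorem eigenvalue_pow_eq_one {x : H 𝕜 m n ξ} {v : V} {μ : 𝕜} {k : ℕ} (hx : x ^ k = 1)
    (hv : v ≠ 0) (h : x • v = μ • v) : μ ^ k = 1 := by
  have h1 := pow_smul_eq h k
  rw [hx, one_smul] at h1
  exact smul_left_injective 𝕜 hv (by simpa using h1.symm)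

theorem mem_dKer {v : V} : v ∈ dKer 𝕜 m n ξ V ↔ hd • v = 0 := Iff.rfl

variable (V) in
theorem dKer_ne_bot [Nontrivial V] : dKer 𝕜 m n ξ V ≠ ⊥ := by
  intro h
  obtain ⟨v, hv⟩ := exists_ne (0 : V)
  have key : ∀ k : ℕ, hd ^ k • v ≠ 0 := by
    intro k
    induction k with
    | zero => simpa using hv
    | succ k ih =>
      intro h0
      rw [pow_succ', mul_smul] at h0
      exact ih ((Submodule.mem_bot 𝕜).1 (h ▸ mem_dKer.2 h0))
  exact key n (by rw [gen_d_pow, zero_smul])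

/-- A nonzero module contains a common eigenvector of `b` and `c` killed by `d`. -/
theorem exists_highest_weight_vector [IsAlgClosed 𝕜] [FiniteDimensional 𝕜 V] [Nontrivial V]
    (hξ : ξ ≠ 0) :
    ∃ (μ lam : 𝕜) (z : V), z ≠ 0 ∧ hd • z = 0 ∧ hb • z = μ • z ∧ hc • z = lam • z := by
  obtain ⟨lam, v, hv, hv0, hcv⟩ := exists_eigenvector_mem
    (Algebra.lsmul 𝕜 𝕜 V hc) (dKer 𝕜 m n ξ V) (dKer_ne_bot V) (by
      intro v hv
      rw [mem_dKer] at hv ⊢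
      rw [Algebra.lsmul_coe, ← mul_smul, gen_d_mul_c, smul_assoc, mul_smul, hv, smul_zero,
        smul_zero])
  obtain ⟨μ, z, hz, hz0, hbz⟩ := exists_eigenvector_mem
    (Algebra.lsmul 𝕜 𝕜 V hb)
    (dKer 𝕜 m n ξ V ⊓ Module.End.eigenspace (Algebra.lsmul 𝕜 𝕜 V hc) lam)
    (fun h => hv0 ((Submodule.mem_bot 𝕜).1 (h ▸ ⟨hv, Module.End.mem_eigenspace_iff.2 hcv⟩)))
    (by
      rintro v ⟨hv, hcv⟩
      refine ⟨?_, ?_⟩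
      · have hv : hd • v = 0 := hv
        have h := congrArg (· • v) (gen_b_mul_d 𝕜 m n ξ)
        simp only [mul_smul, smul_assoc, hv, smul_zero] at h
        exact (smul_eq_zero.1 h.symm).resolve_left (pow_ne_zero m hξ)
      · rw [SetLike.mem_coe, Module.End.mem_eigenspace_iff] at hcv ⊢
        simp only [Algebra.lsmul_coe] at hcv ⊢
        rw [← mul_smul, ← gen_b_mul_c, mul_smul, hcv, smul_comm])
  exact ⟨μ, lam, z, hz0, hz.1, hbz, Module.End.mem_eigenspace_iff.1 hz.2⟩

section WeightVector

variable {μ lam : 𝕜} {z : V}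

theorem gen_b_smul_a_pow (hξ : ξ ≠ 0) (hbz : hb • z = μ • z) (k : ℕ) :
    hb • ha ^ k • z = (((ξ ^ m) ^ k)⁻¹ * μ) • ha ^ k • z := by
  induction k with
  | zero => simpa using hbz
  | succ k ih =>
    have h := congrArg (· • ha ^ k • z) (gen_a_mul_b 𝕜 m n ξ)
    simp only [mul_smul, smul_assoc] at h
    rw [ih] at h
    have hq : ξ ^ m ≠ 0 := pow_ne_zero m hξ
    rw [pow_succ' ha, mul_smul, ← inv_smul_smul₀ hq (hb • ha • ha ^ k • z), ← h,
      smul_comm ha, smul_smul]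
    congr 1
    rw [pow_succ]
    field_simp

/-- The scalar `β_k` with `d a^k z = β_k a^(k-1) z`. -/
def lowerCoeff (m : ℕ) (ξ μ lam : 𝕜) (k : ℕ) : 𝕜 :=
  -∑ t ∈ Finset.range k, (((ξ ^ m) ^ t)⁻¹ * μ - (ξ ^ m) ^ t * lam ^ m)

/-- The action of `c` and `d` on the vectors `a^k z` with `k < n`. -/
theorem gen_cd_smul_a_pow (hξ : ξ ≠ 0) (hdz : hd • z = 0)
    (hbz : hb • z = μ • z) (hcz : hc • z = lam • z) (k : ℕ) (hk : k < n) :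
    hc • ha ^ k • z = (ξ ^ k * lam) • ha ^ k • z ∧
    hd • ha ^ k • z = lowerCoeff m ξ μ lam k • ha ^ (k - 1) • z ∧
    hd ^ (k + 1) • ha ^ k • z = 0 := by
  induction k with
  | zero => simpa [lowerCoeff] using ⟨hcz, hdz⟩
  | succ k ih =>
    obtain ⟨ihc, ihd, ihn⟩ := ih (by omega)
    have hd0 : hd ^ (n - 1) • ha ^ k • z = 0 := by
      rw [show n - 1 = (n - 1 - (k + 1)) + (k + 1) by omega, pow_add, mul_smul, ihn, smul_zero]
    have hdk : hd • ha ^ (k + 1) • z = lowerCoeff m ξ μ lam (k + 1) • ha ^ k • z := by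
      have h := congrArg (· • ha ^ k • z) (gen_a_mul_d 𝕜 m n ξ)
      simp only [sub_smul, mul_smul] at h
      rw [ihd, gen_b_smul_a_pow hξ hbz, pow_smul_eq ihc] at h
      have h2 : ha • lowerCoeff m ξ μ lam k • ha ^ (k - 1) • z =
          lowerCoeff m ξ μ lam k • ha ^ k • z := by
        rcases k with _ | k
        · simp [lowerCoeff]
        · rw [smul_comm, ← mul_smul, ← pow_succ', Nat.add_sub_cancel]
      rw [h2, ← sub_smul, sub_eq_iff_eq_add, ← sub_eq_iff_eq_add', ← sub_smul] at h
      rw [pow_succ', mul_smul, ← h, lowerCoeff, lowerCoeff, Finset.sum_range_succ]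
      congr 1
      ring
    refine ⟨?_, hdk, ?_⟩
    · have h := congrArg (· • ha ^ k • z) (gen_a_mul_c 𝕜 m n ξ)
      simp only [add_smul, mul_smul, smul_assoc] at h
      rw [hd0, smul_zero, smul_zero, add_zero, ihc] at h
      rw [pow_succ' ha, mul_smul, ← smul_inv_smul₀ hξ (hc • ha • ha ^ k • z), ← h,
        smul_comm ha, smul_smul]
      congr 1
      ring
    · rw [pow_succ hd, mul_smul, hdk, smul_comm, ihn, smul_zero]

variable (m n ξ) in
/-- The span of the vectors `a^t z` with `k ≤ t < n`. -/
def tailSpan (k : ℕ) (z : V) : Submodule 𝕜 V :=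
  Submodule.span 𝕜 {v | ∃ t, k ≤ t ∧ t < n ∧ v = ha ^ t • z}

set_option linter.unusedSectionVars false in
theorem a_pow_smul_mem_tailSpan {k t : ℕ} (h1 : k ≤ t) (h2 : t < n) :
    ha ^ t • z ∈ tailSpan m n ξ k z :=
  Submodule.subset_span ⟨t, h1, h2, rfl⟩

theorem gen_smul_mem_tailSpan (hξ : ξ ≠ 0) (hdz : hd • z = 0)
    (hbz : hb • z = μ • z) (hcz : hc • z = lam • z) {k : ℕ}
    (hk : hd • ha ^ k • z = 0) (ha_n : ha ^ n • z ∈ tailSpan m n ξ k z)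
    (g : Fin 4) {v : V} (hv : v ∈ tailSpan m n ξ k z) :
    gen 𝕜 m n ξ g • v ∈ tailSpan m n ξ k z := by
  induction hv using Submodule.span_induction with
  | zero => rw [smul_zero]; exact Submodule.zero_mem _
  | add x y _ _ hx hy => rw [smul_add]; exact Submodule.add_mem _ hx hy
  | smul r x _ hx => rw [smul_comm]; exact Submodule.smul_mem _ _ hx
  | mem v hv =>
    obtain ⟨t, hkt, htn, rfl⟩ := hv
    have hmem := a_pow_smul_mem_tailSpan (m := m) (ξ := ξ) (z := z) hkt htn
    obtain ⟨hct, hdt, -⟩ := gen_cd_smul_a_pow hξ hdz hbz hcz t htn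
    fin_cases g
    · change ha • ha ^ t • z ∈ _
      rw [← mul_smul, ← pow_succ']
      rcases Nat.lt_or_ge (t + 1) n with h | h
      · exact a_pow_smul_mem_tailSpan (by omega) h
      · rwa [show t + 1 = n by omega]
    · change hb • ha ^ t • z ∈ _
      rw [gen_b_smul_a_pow hξ hbz]
      exact Submodule.smul_mem _ _ hmem
    · change hc • ha ^ t • z ∈ _
      rw [hct]
      exact Submodule.smul_mem _ _ hmem
    · change hd • ha ^ t • z ∈ _
      rcases hkt.eq_or_lt with rfl | h
      · rw [hk]; exact Submodule.zero_mem _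
      · rw [hdt]
        exact Submodule.smul_mem _ _ (a_pow_smul_mem_tailSpan (by omega) (by omega))

theorem a_pow_n_smul (hbz : hb • z = μ • z) : ha ^ n • z = (μ ^ n - 1) • z := by
  rw [gen_a_pow, sub_smul, pow_smul_eq hbz, sub_smul, one_smul, one_smul]

theorem tailSpan_zero_eq_top [IsSimpleModule (H 𝕜 m n ξ) V] (hn : 0 < n) (hξ : ξ ≠ 0)
    (hz : z ≠ 0) (hdz : hd • z = 0) (hbz : hb • z = μ • z) (hcz : hc • z = lam • z) :
    tailSpan m n ξ 0 z = ⊤ := by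
  have hmem : z ∈ tailSpan m n ξ 0 z := by
    simpa using a_pow_smul_mem_tailSpan (m := m) (ξ := ξ) (z := z) le_rfl hn
  refine eq_top_of_gen_smul_mem _ (fun g v hv => gen_smul_mem_tailSpan hξ hdz hbz hcz
    (by simpa using hdz) ?_ g hv) hmem hz
  rw [a_pow_n_smul hbz]
  exact Submodule.smul_mem _ _ hmem

theorem weight_injective (hm : 0 < m) (hξ : IsPrimitiveRoot ξ (m * n)) (hlam : lam ≠ 0) :
    Function.Injective fun k : Fin n => ξ ^ (k : ℕ) * lam := by
  intro k l h
  have hle : n ≤ m * n := Nat.le_mul_of_pos_left n hm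
  exact Fin.ext (hξ.pow_inj (k.2.trans_le hle) (l.2.trans_le hle) (mul_right_cancel₀ hlam h))

/-- A vanishing `β_k` with `0 < k < n` forces `μ ^ n = 1`. -/
theorem pow_eq_one_of_lowerCoeff_eq_zero (hξ : IsPrimitiveRoot ξ (m * n)) (hmn : 0 < m * n)
    (hlam : lam ^ (m * n) = 1) {k : ℕ} (hk : 0 < k) (hkn : k < n)
    (h : lowerCoeff m ξ μ lam k = 0) : μ ^ n = 1 := by
  have hq : IsPrimitiveRoot (ξ ^ m) n := hξ.pow hmn rfl
  set q := ξ ^ m with hqdef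
  have hq0 : q ≠ 0 := hq.ne_zero (by omega)
  have hsum : ∑ t ∈ Finset.range k, q ^ t ≠ 0 := by
    intro h0
    have := geom_sum_mul q k
    rw [h0, zero_mul, eq_comm, sub_eq_zero] at this
    exact hq.pow_ne_one_of_pos_of_lt hk.ne' hkn this
  have hinv : ∑ t ∈ Finset.range k, (q ^ t)⁻¹ =
      (q ^ (k - 1))⁻¹ * ∑ t ∈ Finset.range k, q ^ t := by
    rw [← Finset.sum_range_reflect (fun t => q ^ t), Finset.mul_sum]
    refine Finset.sum_congr rfl fun t ht => ?_
    have ht := Finset.mem_range.1 ht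
    rw [show k - 1 = (k - 1 - t) + t by omega, pow_add, Nat.add_sub_cancel]
    field_simp
  rw [lowerCoeff, neg_eq_zero, Finset.sum_sub_distrib, ← Finset.sum_mul, ← Finset.sum_mul,
    ← hqdef, hinv, mul_right_comm, mul_comm (∑ t ∈ Finset.range k, q ^ t) (lam ^ m),
    ← sub_mul, mul_eq_zero, or_iff_left hsum, sub_eq_zero] at h
  have hμ : μ = q ^ (k - 1) * lam ^ m := by rw [← h]; field_simp
  rw [hμ, mul_pow, ← pow_mul lam, hlam, mul_one, pow_right_comm, hq.pow_eq_one, one_pow]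

/-- Below the top vector, `d` does not annihilate the vectors `a^k z` of a simple module. -/
theorem lowerCoeff_ne_zero [IsSimpleModule (H 𝕜 m n ξ) V] (hm : 0 < m)
    (hξ : IsPrimitiveRoot ξ (m * n)) (hz : z ≠ 0) (hdz : hd • z = 0) (hbz : hb • z = μ • z)
    (hcz : hc • z = lam • z) {k : ℕ} (hk : 0 < k) (hkn : k < n) (hne : ha ^ k • z ≠ 0) :
    lowerCoeff m ξ μ lam k ≠ 0 := by
  intro h
  have hmn : 0 < m * n := Nat.mul_pos hm (by omega)
  have hξ0 : ξ ≠ 0 := hξ.ne_zero hmn.ne'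
  have hlam := eigenvalue_pow_eq_one (gen_c_pow 𝕜 m n ξ) hz hcz
  have hlam0 : lam ≠ 0 := fun h0 => by simp [h0, hmn.ne'] at hlam
  have hμ := pow_eq_one_of_lowerCoeff_eq_zero hξ hmn hlam hk hkn h
  have htop : tailSpan m n ξ k z = ⊤ := by
    refine eq_top_of_gen_smul_mem _ (fun g v hv => gen_smul_mem_tailSpan hξ0 hdz hbz hcz
      ?_ ?_ g hv) (a_pow_smul_mem_tailSpan le_rfl hkn) hne
    · rw [(gen_cd_smul_a_pow hξ0 hdz hbz hcz k hkn).2.1, h, zero_smul]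
    · rw [a_pow_n_smul hbz, hμ, sub_self, zero_smul]
      exact Submodule.zero_mem _
  have hind := (Module.End.eigenspaces_iSupIndep (Algebra.lsmul 𝕜 𝕜 V hc)).comp
    (weight_injective hm hξ hlam0)
  have hle : tailSpan m n ξ k z ≤ ⨆ j : Fin n, ⨆ (_ : j ≠ ⟨0, by omega⟩),
      Module.End.eigenspace (Algebra.lsmul 𝕜 𝕜 V hc) (ξ ^ (j : ℕ) * lam) := by
    refine Submodule.span_le.2 ?_
    rintro _ ⟨t, hkt, htn, rfl⟩
    refine Submodule.mem_iSup_of_mem ⟨t, htn⟩ (Submodule.mem_iSup_of_mem ?_ ?_)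
    · simp only [ne_eq, Fin.mk.injEq]; omega
    · exact Module.End.mem_eigenspace_iff.2 (gen_cd_smul_a_pow hξ0 hdz hbz hcz t htn).1
  refine hz (Submodule.disjoint_def.1 (hind ⟨0, by omega⟩) z ?_ (hle (htop ▸ Submodule.mem_top)))
  exact Module.End.mem_eigenspace_iff.2 (by simpa using hcz)

/-- In a simple module, `M^d` is spanned by any highest weight vector. -/
theorem dKer_le_span_singleton [IsSimpleModule (H 𝕜 m n ξ) V] (hm : 0 < m) (hn : 0 < n)
    (hξ : IsPrimitiveRoot ξ (m * n)) (hz : z ≠ 0) (hdz : hd • z = 0) (hbz : hb • z = μ • z)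
    (hcz : hc • z = lam • z) : dKer 𝕜 m n ξ V ≤ Submodule.span 𝕜 {z} := by
  intro w hw
  have hmn : 0 < m * n := Nat.mul_pos hm hn
  have hξ0 : ξ ≠ 0 := hξ.ne_zero hmn.ne'
  have hlam := eigenvalue_pow_eq_one (gen_c_pow 𝕜 m n ξ) hz hcz
  have hlam0 : lam ≠ 0 := fun h0 => by simp [h0, hmn.ne'] at hlam
  have hset : {v | ∃ t, 0 ≤ t ∧ t < n ∧ v = ha ^ t • z} =
      Set.range fun k : Fin n => ha ^ (k : ℕ) • z := by
    ext v
    constructor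
    · rintro ⟨t, -, ht, rfl⟩
      exact ⟨⟨t, ht⟩, rfl⟩
    · rintro ⟨k, rfl⟩
      exact ⟨k, Nat.zero_le _, k.2, rfl⟩
  have hwtop : w ∈ tailSpan m n ξ 0 z := by
    rw [tailSpan_zero_eq_top hn hξ0 hz hdz hbz hcz]
    exact Submodule.mem_top
  rw [tailSpan, hset, Submodule.mem_span_range_iff_exists_fun] at hwtop
  obtain ⟨x, rfl⟩ := hwtop
  have hind := (iSupIndep_iff_finsetSum_eq_zero_imp_eq_zero _).1
    ((Module.End.eigenspaces_iSupIndep (Algebra.lsmul 𝕜 𝕜 V hc)).comp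
      (weight_injective hm hξ (mul_ne_zero (inv_ne_zero hξ0) hlam0)))
    Finset.univ (fun i => hd • x i • ha ^ (i : ℕ) • z) (fun i _ => by
      refine Module.End.mem_eigenspace_iff.2 ?_
      obtain ⟨hci, hdi, -⟩ := gen_cd_smul_a_pow hξ0 hdz hbz hcz i i.2
      have h := congrArg (· • ha ^ (i : ℕ) • z) (gen_d_mul_c 𝕜 m n ξ)
      simp only [mul_smul, smul_assoc] at h
      rw [hci] at h
      change hc • hd • x i • ha ^ (i : ℕ) • z =
        (ξ ^ (i : ℕ) * (ξ⁻¹ * lam)) • hd • x i • ha ^ (i : ℕ) • z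
      rw [smul_comm hd (x i), smul_comm hc (x i),
        ← inv_smul_smul₀ hξ0 (hc • hd • ha ^ (i : ℕ) • z), ← h,
        smul_comm hd (ξ ^ (i : ℕ) * lam)]
      simp only [smul_smul]
      congr 1
      ring) (by rw [← Finset.smul_sum]; exact hw)
  refine Submodule.sum_mem _ fun i _ => ?_
  have hdi := hind i (Finset.mem_univ i)
  obtain ⟨_ | k, hk⟩ := i
  · exact Submodule.smul_mem _ _ (by simp)
  · rw [smul_comm, (gen_cd_smul_a_pow hξ0 hdz hbz hcz (k + 1) hk).2.1, smul_eq_zero,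
      smul_eq_zero, Nat.add_sub_cancel] at hdi
    have h0 : x ⟨k + 1, hk⟩ • ha ^ (k + 1) • z = 0 := by
      by_cases hne : ha ^ (k + 1) • z = 0
      · rw [hne, smul_zero]
      · have hne' : ha ^ k • z ≠ 0 := fun h => hne (by rw [pow_succ', mul_smul, h, smul_zero])
        have hβ := lowerCoeff_ne_zero hm hξ hz hdz hbz hcz k.succ_pos hk hne
        rw [hdi.resolve_right (not_or.2 ⟨hβ, hne'⟩), zero_smul]
    rw [h0]
    exact Submodule.zero_mem _

end WeightVector

end DKernel

section Length

variable {𝕜 m n ξ}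
variable {V : Type} [AddCommGroup V] [Module 𝕜 V] [Module (H 𝕜 m n ξ) V]
  [IsScalarTower 𝕜 (H 𝕜 m n ξ) V]

theorem finrank_dKer_inf_of_isAtom [IsAlgClosed 𝕜] [FiniteDimensional 𝕜 V] (hm : 0 < m)
    (hn : 0 < n) (hξ : IsPrimitiveRoot ξ (m * n)) {S : Submodule (H 𝕜 m n ξ) V}
    (hS : IsAtom S) :
    Module.finrank 𝕜 (dKer 𝕜 m n ξ V ⊓ S.restrictScalars 𝕜 : Submodule 𝕜 V) = 1 := by
  have : IsSimpleModule (H 𝕜 m n ξ) S := isSimpleModule_iff_isAtom.2 hS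
  have : Nontrivial S := IsSimpleModule.nontrivial (H 𝕜 m n ξ) S
  have : FiniteDimensional 𝕜 S :=
    inferInstanceAs (FiniteDimensional 𝕜 (S.restrictScalars 𝕜))
  obtain ⟨μ, lam, z, hz, hdz, hbz, hcz⟩ := exists_highest_weight_vector
    (m := m) (n := n) (V := S) (hξ.ne_zero (Nat.mul_pos hm hn).ne')
  have hspan : dKer 𝕜 m n ξ V ⊓ S.restrictScalars 𝕜 = Submodule.span 𝕜 {(z : V)} := by
    refine le_antisymm ?_ ?_
    · rintro v ⟨hv, hvS⟩
      have h := dKer_le_span_singleton hm hn hξ hz hdz hbz hcz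
        (show (⟨v, hvS⟩ : S) ∈ dKer 𝕜 m n ξ S from Subtype.ext hv)
      obtain ⟨r, hr⟩ := Submodule.mem_span_singleton.1 h
      exact Submodule.mem_span_singleton.2 ⟨r, congrArg Subtype.val hr⟩
    · rw [Submodule.span_singleton_le_iff_mem]
      exact ⟨congrArg Subtype.val hdz, z.2⟩
  rw [hspan, finrank_span_singleton fun h => hz (Subtype.ext h)]

theorem finrank_dKer_inf_of_covBy [IsAlgClosed 𝕜] [FiniteDimensional 𝕜 V] (hm : 0 < m)
    (hn : 0 < n) (hξ : IsPrimitiveRoot ξ (m * n)) [IsSemisimpleModule (H 𝕜 m n ξ) V]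
    {N N' : Submodule (H 𝕜 m n ξ) V} (h : N ⋖ N') :
    Module.finrank 𝕜 (dKer 𝕜 m n ξ V ⊓ N'.restrictScalars 𝕜 : Submodule 𝕜 V) =
      Module.finrank 𝕜 (dKer 𝕜 m n ξ V ⊓ N.restrictScalars 𝕜 : Submodule 𝕜 V) + 1 := by
  obtain ⟨C, hC⟩ := exists_isCompl N
  set S := C ⊓ N' with hSdef
  have hdisj : N ⊓ S = ⊥ := by rw [hSdef, ← inf_assoc, hC.inf_eq_bot, bot_inf_eq]
  have hsup : N ⊔ S = N' := by
    rw [hSdef, ← sup_inf_assoc_of_le C h.le, hC.sup_eq_top, top_inf_eq]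
  have hS : IsAtom S := by
    rw [← bot_covBy_iff, ← hdisj]
    exact inf_covBy_of_covBy_sup_left (hsup.symm ▸ h)
  rw [← finrank_dKer_inf_of_isAtom hm hn hξ hS, ← Submodule.finrank_sup_add_finrank_inf_eq]
  have hinf : (dKer 𝕜 m n ξ V ⊓ N.restrictScalars 𝕜) ⊓
      (dKer 𝕜 m n ξ V ⊓ S.restrictScalars 𝕜) = ⊥ := by
    refine eq_bot_iff.2 fun v hv => ?_
    have : v ∈ N ⊓ S := ⟨hv.1.2, hv.2.2⟩
    simpa [hdisj] using this
  rw [hinf, finrank_bot, add_zero]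
  suffices hsum : dKer 𝕜 m n ξ V ⊓ N'.restrictScalars 𝕜 =
      dKer 𝕜 m n ξ V ⊓ N.restrictScalars 𝕜 ⊔ dKer 𝕜 m n ξ V ⊓ S.restrictScalars 𝕜 by rw [hsum]
  refine le_antisymm ?_ (sup_le (inf_le_inf_left _ h.le)
    (inf_le_inf_left _ (show S ≤ N' from inf_le_right)))
  rintro v ⟨hv, hvN⟩
  obtain ⟨x, hx, y, hy, rfl⟩ := Submodule.mem_sup.1 (hsup.symm ▸ hvN : v ∈ N ⊔ S)
  have hv : hd • (x + y) = 0 := hv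
  rw [smul_add] at hv
  have hx0 : hd • x = 0 := by
    have : hd • x ∈ N ⊓ S := ⟨N.smul_mem _ hx, by
      rw [eq_neg_of_add_eq_zero_left hv]
      exact S.neg_mem (S.smul_mem _ hy)⟩
    simpa [hdisj] using this
  rw [hx0, zero_add] at hv
  exact Submodule.add_mem_sup ⟨hx0, hx⟩ ⟨hv, hy⟩

end Length

/-- Corollary 3.4: a finite dimensional semisimple `H_{mn}(ξ)`-module `M`
has composition length equal to `dim_𝕜 M^d`, where `M^d = {v ∈ M | d•v = 0}`. -/
theorem statement6 (𝕜 : Type) [Field 𝕜] [IsAlgClosed 𝕜] (m n : ℕ) (hm : 1 < m) (hn : 1 < n)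
    (ξ : 𝕜) (hξ : IsPrimitiveRoot ξ (m * n))
    (M : Type) [AddCommGroup M] [Module 𝕜 M] [Module (H 𝕜 m n ξ) M]
    [IsScalarTower 𝕜 (H 𝕜 m n ξ) M] [FiniteDimensional 𝕜 M]
    (hM : IsSemisimpleModule (H 𝕜 m n ξ) M) :
    lengthIs 𝕜 m n ξ M (Module.finrank 𝕜 (dKer 𝕜 m n ξ M)) := by
  have := isNoetherian_of_tower 𝕜 (inferInstance : IsNoetherian 𝕜 M) (S := H 𝕜 m n ξ)
  have := isArtinian_of_tower 𝕜 (inferInstance : IsArtinian 𝕜 M) (S := H 𝕜 m n ξ)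
  obtain ⟨s, hhead, hlast⟩ := isFiniteLength_iff_exists_compositionSeries.1
    (isFiniteLength_iff_isNoetherian_isArtinian.2
      ⟨‹IsNoetherian (H 𝕜 m n ξ) M›, ‹IsArtinian (H 𝕜 m n ξ) M›⟩)
  refine ⟨s, hhead, hlast, ?_⟩
  have hrank : ∀ i : Fin (s.length + 1), Module.finrank 𝕜
      (dKer 𝕜 m n ξ M ⊓ (s i).restrictScalars 𝕜 : Submodule 𝕜 M) = i := by
    intro i
    induction i using Fin.induction with
    | zero =>
      have h0 : s 0 = ⊥ := hhead
      rw [h0, Submodule.restrictScalars_bot, inf_bot_eq, finrank_bot, Fin.val_zero]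
    | succ i ih =>
      rw [finrank_dKer_inf_of_covBy (by omega) (by omega) hξ (s.step i), ih]
      simp
  have hl : s (Fin.last s.length) = ⊤ := hlast
  have h := hrank (Fin.last s.length)
  rw [hl, Submodule.restrictScalars_top, inf_top_eq, Fin.val_last] at h
  exact h.symm

end Radford
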